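/- The finite-degree hypothesis in the simulation characterization theorem is necessary: let σ = {a} with a binary, let B be the σ-structure with domain {0} ∪ {(i,j) : i ≥ 1, 1 ≤ j ≤ i} and a-edges from 0 to each (i,1) and from (i,j) to (i,j+1) for j+1 ≤ i (a tree having, for each n ≥ 1, exactly one branch of length n), and let A be B extended with an additional infinite branch (ω,1),(ω,2),… with a-edges from 0 to (ω,1) and from (ω,j) to (ω,j+1). Then A,0 and B,0 satisfy exactly the same positive UCPDL⁺ formulas, yet A,0 ⋠₂ B,0 (Spoiler wins the 2-pebble simulation game from A,0 to B,0), and hence also A,0 ⋠ᵁ₂ B,0. -/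

import Mathlib

namespace PaperCPDL

/-- Relational structures over a fixed countably infinite signature:
for every arity `n` there are countably many relation names, indexed by `ℕ`. -/
structure Struct : Type 1 where
  World : Type
  rel : (n : ℕ) → ℕ → (Fin n → World) → Prop

namespace Struct

variable (K : Struct)

/-- Atomic propositions are the unary relation names. -/
def prop (p : ℕ) (w : K.World) : Prop := K.rel 1 p fun _ => w

/-- Atomic programs are the binary relation names. -/
def prog (a : ℕ) (u v : K.World) : Prop :=
  K.rel 2 a fun i => if (i : ℕ) = 0 then u else v

/-- A Kripke structure interprets every relation of arity `> 2` as the empty relation. -/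
def IsKripke : Prop := ∀ n, 2 < n → ∀ r (t : Fin n → K.World), ¬ K.rel n r t

/-- Gaifman adjacency: `u` and `v` occur together in a tuple of some relation. -/
def gadj (u v : K.World) : Prop :=
  ∃ (n r : ℕ) (t : Fin n → K.World), K.rel n r t ∧ (∃ i, t i = u) ∧ ∃ j, t j = v

/-- distance at most 1 in the Gaifman graph. -/
def near (u v : K.World) : Prop := u = v ∨ K.gadj u v

/-- same connected component of the Gaifman graph. -/
def sameComp (u v : K.World) : Prop := Relation.ReflTransGen K.gadj u v

/-- finite degree: every world has finitely many Gaifman-neighbours. -/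
def FiniteDegree : Prop := ∀ u, {v | K.gadj u v}.Finite

end Struct

/-- r-atoms `R(x₁,…,xₙ)`: a relation name with its argument variables. -/
structure RAtom where
  name : ℕ
  args : List ℕ

mutual
  /-- Formulas of (U)CPDL⁺ (together with `loop` and program intersection,
  used to carve out the various fragments). -/
  inductive Fml : Type where
    | prop : ℕ → Fml
    | neg : Fml → Fml
    | and : Fml → Fml → Fml
    | diam : Prog → Fml
    | loop : Prog → Fml
  /-- Programs. -/
  inductive Prog : Type where
    | eps : Prog
    | atom : ℕ → Prog
    | conv : ℕ → Prog
    | union : Prog → Prog → Prog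
    | comp : Prog → Prog → Prog
    | star : Prog → Prog
    | test : Fml → Prog
    | inter : Prog → Prog → Prog
    | univ : Prog
    | cq : PList → List RAtom → ℕ → ℕ → Prog
  /-- Finite lists of p-atoms `π(x,y)`. -/
  inductive PList : Type where
    | nil : PList
    | cons : Prog → ℕ → ℕ → PList → PList
end

/-- satisfaction of an r-atom under an assignment. -/
def Struct.ratomSat (K : Struct) (f : ℕ → K.World) (r : RAtom) : Prop :=
  K.rel r.args.length r.name fun i => f (r.args.get i)

mutual
  /-- semantics of formulas. -/
  def evalF (K : Struct) : Fml → K.World → Prop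
    | .prop p, w => K.prop p w
    | .neg φ, w => ¬ evalF K φ w
    | .and φ ψ, w => evalF K φ w ∧ evalF K ψ w
    | .diam π, w => ∃ v, evalP K π w v
    | .loop π, w => evalP K π w w
  /-- semantics of programs. -/
  def evalP (K : Struct) : Prog → K.World → K.World → Prop
    | .eps, u, v => u = v
    | .atom a, u, v => K.prog a u v
    | .conv a, u, v => K.prog a v u
    | .union π₁ π₂, u, v => evalP K π₁ u v ∨ evalP K π₂ u v
    | .comp π₁ π₂, u, v => ∃ w, evalP K π₁ u w ∧ evalP K π₂ w v
    | .star π, u, v => Relation.ReflTransGen (fun a b => evalP K π a b) u v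
    | .test φ, u, v => u = v ∧ evalF K φ u
    | .inter π₁ π₂, u, v => evalP K π₁ u v ∧ evalP K π₂ u v
    | .univ, _, _ => True
    | .cq ps rs xs xt, u, v =>
        ∃ f : ℕ → K.World, f xs = u ∧ f xt = v ∧ evalPL K f ps ∧ ∀ r ∈ rs, K.ratomSat f r
  /-- semantics of a list of p-atoms. -/
  def evalPL (K : Struct) (f : ℕ → K.World) : PList → Prop
    | .nil => True
    | .cons π x y ps => evalP K π (f x) (f y) ∧ evalPL K f ps
end

/-! ## Conjunctive programs: variables, underlying graph, well-formedness -/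

/-- variables occurring in a list of p-atoms. -/
def PList.vars : PList → List ℕ
  | .nil => []
  | .cons _ x y ps => x :: y :: ps.vars

/-- variables of a conjunctive program given by p-atoms `ps` and r-atoms `rs`. -/
def cqVars (ps : PList) (rs : List RAtom) : List ℕ :=
  ps.vars ++ (rs.map RAtom.args).flatten

/-- co-occurrence of two variables in a p-atom of the list. -/
def PList.coOcc (x y : ℕ) : PList → Prop
  | .nil => False
  | .cons _ a b ps => ((x = a ∨ x = b) ∧ (y = a ∨ y = b)) ∨ PList.coOcc x y ps

/-- adjacency in the graph `G_C`: co-occurrence of two variables in some atom. -/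
def atomAdj (ps : PList) (rs : List RAtom) (x y : ℕ) : Prop :=
  ps.coOcc x y ∨ ∃ r ∈ rs, x ∈ r.args ∧ y ∈ r.args

/-- adjacency in the underlying graph of `C[x_s,x_t]`: `G_C` plus the edge `{x_s,x_t}`. -/
def ugAdj (ps : PList) (rs : List RAtom) (xs xt : ℕ) (x y : ℕ) : Prop :=
  atomAdj ps rs x y ∨ (x = xs ∧ y = xt) ∨ (x = xt ∧ y = xs)

/-- base well-formedness of a conjunctive program `C[x_s,x_t]`:
`x_s,x_t ∈ Vars(C)`, every r-atom has arity `> 2`, and `G_C` is connected. -/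
def cqWF (ps : PList) (rs : List RAtom) (xs xt : ℕ) : Prop :=
  xs ∈ cqVars ps rs ∧ xt ∈ cqVars ps rs ∧
  (∀ r ∈ rs, 2 < r.args.length) ∧
  ∀ x ∈ cqVars ps rs, ∀ y ∈ cqVars ps rs, Relation.ReflTransGen (atomAdj ps rs) x y

/-! ## Tree decompositions and tree-width -/

/-- A tree decomposition of the graph with vertex set `V` and adjacency `adj`. -/
structure TreeDecomp {α : Type} (V : Set α) (adj : α → α → Prop) where
  /-- the nodes of the tree -/
  B : Type
  /-- the tree -/
  tree : SimpleGraph B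
  isTree : tree.IsTree
  /-- the bags -/
  bag : B → Set α
  cover_vert : ∀ v ∈ V, ∃ b, v ∈ bag b
  cover_edge : ∀ u v, adj u v → ∃ b, u ∈ bag b ∧ v ∈ bag b
  bags_conn : ∀ (v : α) (b₁ b₂ : B), v ∈ bag b₁ → v ∈ bag b₂ →
      ∃ p : tree.Walk b₁ b₂, ∀ x ∈ p.support, v ∈ bag x

/-- the width of a tree decomposition is at most `k`. -/
def TreeDecomp.WidthLE {α : Type} {V : Set α} {adj : α → α → Prop}
    (td : TreeDecomp V adj) (k : ℕ) : Prop :=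
  ∀ b, (td.bag b).Finite ∧ (td.bag b).ncard ≤ k + 1

/-- the graph `(V, adj)` has tree-width at most `k`. -/
def TreewidthLE {α : Type} (V : Set α) (adj : α → α → Prop) (k : ℕ) : Prop :=
  ∃ td : TreeDecomp V adj, td.WidthLE k

/-- the Gaifman graph of the structure `K` has tree-width at most `k`. -/
def Struct.twLE (K : Struct) (k : ℕ) : Prop :=
  TreewidthLE (Set.univ : Set K.World) K.gadj k

/-- A good tree decomposition: along every tree edge one bag contains the other,
and the tree is binary (it has a root of degree `≤ 2`, all other nodes have degree `≤ 3`). -/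
def TreeDecomp.Good {α : Type} {V : Set α} {adj : α → α → Prop} (td : TreeDecomp V adj) : Prop :=
  (∀ b b', td.tree.Adj b b' → td.bag b ⊆ td.bag b' ∨ td.bag b' ⊆ td.bag b) ∧
  ∃ r : td.B, ∀ b, {b' | td.tree.Adj b b'}.Finite ∧
    ((b = r → {b' | td.tree.Adj b b'}.ncard ≤ 2) ∧ (b ≠ r → {b' | td.tree.Adj b b'}.ncard ≤ 3))

/-! ## Fragments -/

/-- all p-atoms of the list are of the form `π(x,x)` for the fixed variable `x`. -/
def PList.allOn (x : ℕ) : PList → Prop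
  | .nil => True
  | .cons _ a b ps => a = x ∧ b = x ∧ PList.allOn x ps

/-- A fragment specification: which of `loop`, `∩`, `U` are allowed, and which
shapes of conjunctive programs are allowed. -/
structure Frag where
  loopOK : Prop
  interOK : Prop
  univOK : Prop
  cqOK : PList → List RAtom → ℕ → ℕ → Prop

mutual
  /-- the formula belongs to the fragment `F`. -/
  def Fml.In : Frag → Fml → Prop
    | _, .prop _ => True
    | F, .neg φ => Fml.In F φ
    | F, .and φ ψ => Fml.In F φ ∧ Fml.In F ψ
    | F, .diam π => Prog.In F π
    | F, .loop π => F.loopOK ∧ Prog.In F π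
  /-- the program belongs to the fragment `F`. -/
  def Prog.In : Frag → Prog → Prop
    | _, .eps => True
    | _, .atom _ => True
    | _, .conv _ => True
    | F, .union π₁ π₂ => Prog.In F π₁ ∧ Prog.In F π₂
    | F, .comp π₁ π₂ => Prog.In F π₁ ∧ Prog.In F π₂
    | F, .star π => Prog.In F π
    | F, .test φ => Fml.In F φ
    | F, .inter π₁ π₂ => F.interOK ∧ Prog.In F π₁ ∧ Prog.In F π₂
    | F, .univ => F.univOK
    | F, .cq ps rs xs xt => F.cqOK ps rs xs xt ∧ cqWF ps rs xs xt ∧ PList.In F ps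
  /-- all programs of the list belong to the fragment `F`. -/
  def PList.In : Frag → PList → Prop
    | _, .nil => True
    | F, .cons π _ _ ps => Prog.In F π ∧ PList.In F ps
end

/-- CPDL: PDL with converse. -/
def Frag.cpdl : Frag := ⟨False, False, False, fun _ _ _ _ => False⟩
/-- ICPDL: CPDL with program intersection. -/
def Frag.icpdl : Frag := ⟨False, True, False, fun _ _ _ _ => False⟩
/-- loop-CPDL: CPDL with `loop(π)` formulas. -/
def Frag.loopCpdl : Frag := ⟨True, False, False, fun _ _ _ _ => False⟩
/-- CPDL⁺: CPDL with conjunctive programs. -/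
def Frag.cpdlPlus : Frag := ⟨False, False, False, fun _ _ _ _ => True⟩
/-- UCPDL⁺: CPDL⁺ with the universal program. -/
def Frag.ucpdlPlus : Frag := ⟨False, False, True, fun _ _ _ _ => True⟩
/-- CPDL⁺(TW_k): conjunctive programs with underlying graph of tree-width `≤ k`. -/
def Frag.tw (k : ℕ) : Frag :=
  ⟨False, False, False, fun ps rs xs xt =>
    TreewidthLE {x | x ∈ cqVars ps rs} (ugAdj ps rs xs xt) k⟩
/-- UCPDL⁺(TW_k). -/
def Frag.utw (k : ℕ) : Frag :=
  ⟨False, False, True, fun ps rs xs xt =>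
    TreewidthLE {x | x ∈ cqVars ps rs} (ugAdj ps rs xs xt) k⟩
/-- CPDL⁺(𝒢↺): the only conjunctive programs are `C[x,x]` where all atoms
are p-atoms of the form `π(x,x)`. -/
def Frag.gloop : Frag :=
  ⟨False, False, False, fun ps rs xs xt => xt = xs ∧ rs = [] ∧ PList.allOn xs ps⟩
/-- ICPDL⁺(TW₂): CPDL⁺(TW₂) together with program intersection. -/
def Frag.icpdlPlusTw2 : Frag :=
  ⟨False, True, False, fun ps rs xs xt =>
    TreewidthLE {x | x ∈ cqVars ps rs} (ugAdj ps rs xs xt) 2⟩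

mutual
  /-- positive formulas: no occurrence of negation. -/
  def Fml.Positive : Fml → Prop
    | .prop _ => True
    | .neg _ => False
    | .and φ ψ => Fml.Positive φ ∧ Fml.Positive ψ
    | .diam π => Prog.Positive π
    | .loop π => Prog.Positive π
  /-- positive programs. -/
  def Prog.Positive : Prog → Prop
    | .eps => True
    | .atom _ => True
    | .conv _ => True
    | .union π₁ π₂ => Prog.Positive π₁ ∧ Prog.Positive π₂
    | .comp π₁ π₂ => Prog.Positive π₁ ∧ Prog.Positive π₂
    | .star π => Prog.Positive π
    | .test φ => Fml.Positive φ
    | .inter π₁ π₂ => Prog.Positive π₁ ∧ Prog.Positive π₂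
    | .univ => True
    | .cq ps _ _ _ => PList.Positive ps
  /-- positive p-atom lists. -/
  def PList.Positive : PList → Prop
    | .nil => True
    | .cons π _ _ ps => Prog.Positive π ∧ PList.Positive ps
end

/-! ## Pebble games -/

/-- A two-player arena; the winning condition for Duplicator is "any infinite play"
(the stuck player loses). -/
structure GameArena (Pos : Type) where
  /-- positions owned by Spoiler -/
  spoiler : Pos → Prop
  /-- the moves -/
  move : Pos → Pos → Prop

/-- `W` is a set of positions from which Duplicator survives forever: it is closed
under all Spoiler moves and from each Duplicator position of `W` some move stays in `W`. -/
def GameArena.Invariant {Pos : Type} (G : GameArena Pos) (W : Set Pos) : Prop :=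
  ∀ q ∈ W, (G.spoiler q → ∀ q', G.move q q' → q' ∈ W) ∧
    (¬ G.spoiler q → ∃ q', G.move q q' ∧ q' ∈ W)

/-- Duplicator has a winning strategy from `q` (coinductive characterization of
winning regions of safety games). -/
def GameArena.DupWins {Pos : Type} (G : GameArena Pos) (q : Pos) : Prop :=
  ∃ W : Set Pos, G.Invariant W ∧ q ∈ W

/-- `(u,v) ∈ Homs_m(K,K')`: the assignment `u i ↦ v i` is a well-defined partial
homomorphism from `K` to `K'`. -/
def tupHom (K K' : Struct) {m : ℕ} (u : Fin m → K.World) (v : Fin m → K'.World) : Prop :=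
  (∀ i j, u i = u j → v i = v j) ∧
  ∀ (n r : ℕ) (t : Fin n → Fin m),
    K.rel n r (fun i => u (t i)) → K'.rel n r fun i => v (t i)

/-- Game positions: Spoiler positions `S ū v̄` and Duplicator positions `D i ū v̄`
(`i = none` is the position `d₀` of the U-games). -/
inductive GPos (A B : Type) (m : ℕ) : Type where
  | S : (Fin m → A) → (Fin m → B) → GPos A B m
  | D : Option (Fin m) → (Fin m → A) → (Fin m → B) → GPos A B m

/-- Spoiler's positions. -/
def GPos.isS {A B : Type} {m : ℕ} : GPos A B m → Prop
  | .S _ _ => True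
  | .D _ _ _ => False

/-- moves of the `m`-pebble simulation game on `(K,K')`; `withU` enables the
additional `d₀` moves of the U-simulation game. -/
def simMove (K K' : Struct) (m : ℕ) (withU : Bool) :
    GPos K.World K'.World m → GPos K.World K'.World m → Prop
  | .S u v, .D (some i) u' v' =>
      v' = v ∧ ∃ w, u' = Function.update u i w ∧ ∃ j, j ≠ i ∧ K.near (u j) w
  | .S _ v, .D none u' v' =>
      withU = true ∧ v' = v ∧ ∀ i j, u' i = u' j
  | .D (some i) u v, .S u' v' =>
      u' = u ∧ (∃ w, v' = Function.update v i w ∧ ∃ j, j ≠ i ∧ K'.near (v j) w) ∧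
      tupHom K K' u' v'
  | .D none u v, .S u' v' =>
      u' = u ∧ (∀ i j, v' i = v' j) ∧ tupHom K K' u' v'
  | _, _ => False

/-- the `m`-pebble (U-)simulation game. -/
def simGame (K K' : Struct) (m : ℕ) (withU : Bool) : GameArena (GPos K.World K'.World m) :=
  ⟨GPos.isS, simMove K K' m withU⟩

/-- `K,ū ⪯_m K',v̄`: `m`-pebble simulation. -/
def PebbleSim (K K' : Struct) (m : ℕ) (u : Fin m → K.World) (v : Fin m → K'.World) : Prop :=
  (∀ i j, K.sameComp (u i) (u j)) →
    tupHom K K' u v ∧ (simGame K K' m false).DupWins (.S u v)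

/-- `K,ū ⪯ᵁ_m K',v̄`: `m`-pebble U-simulation. -/
def PebbleSimU (K K' : Struct) (m : ℕ) (u : Fin m → K.World) (v : Fin m → K'.World) : Prop :=
  tupHom K K' u v ∧ (simGame K K' m true).DupWins (.S u v)

/-- the disjoint union of two structures. -/
def Struct.sum (K K' : Struct) : Struct where
  World := K.World ⊕ K'.World
  rel n r t :=
    (∃ t₀ : Fin n → K.World, t = (fun i => Sum.inl (t₀ i)) ∧ K.rel n r t₀) ∨
    ∃ t₁ : Fin n → K'.World, t = (fun i => Sum.inr (t₁ i)) ∧ K'.rel n r t₁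

/-- moves of the `m`-pebble bisimulation game, played on the disjoint union `U`;
`side` tells which of the two structures hosts a world.  Besides the simulation
moves, Spoiler may swap the two tuples whenever all his pebbles are stacked,
and (`withU`) may stack all his pebbles anywhere in his current structure. -/
def bisimMove (U : Struct) (m : ℕ) (withU : Bool) (side : U.World → Bool) :
    GPos U.World U.World m → GPos U.World U.World m → Prop
  | .S u v, .D (some i) u' v' =>
      v' = v ∧ ∃ w, u' = Function.update u i w ∧ ∃ j, j ≠ i ∧ U.near (u j) w
  | .S u v, .S u' v' =>
      u' = v ∧ v' = u ∧ ∀ i j, u i = u j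
  | .S u v, .D none u' v' =>
      withU = true ∧ v' = v ∧ (∀ i j, u' i = u' j) ∧ ∀ i j, side (u' i) = side (u j)
  | .D (some i) u v, .S u' v' =>
      u' = u ∧ (∃ w, v' = Function.update v i w ∧ ∃ j, j ≠ i ∧ U.near (v j) w) ∧
      tupHom U U u' v' ∧ ∀ i j, side (u' i) ≠ side (v' j)
  | .D none u v, .S u' v' =>
      u' = u ∧ (∀ i j, v' i = v' j) ∧ tupHom U U u' v' ∧ ∀ i j, side (u' i) ≠ side (v' j)
  | _, _ => False

/-- the `m`-pebble (U-)bisimulation game on `(K,K')`. -/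
def bisimGame (K K' : Struct) (m : ℕ) (withU : Bool) :
    GameArena (GPos (K.sum K').World (K.sum K').World m) :=
  ⟨GPos.isS, bisimMove (K.sum K') m withU (fun w => Sum.isLeft w)⟩

/-- `K,ū ⪯ʰ_m K',v̄`: `m`-half-bisimulation. -/
def HalfBisim (K K' : Struct) (m : ℕ) (u : Fin m → K.World) (v : Fin m → K'.World) : Prop :=
  (∀ i j, K.sameComp (u i) (u j)) →
    tupHom K K' u v ∧
    (bisimGame K K' m false).DupWins (.S (fun i => Sum.inl (u i)) (fun i => Sum.inr (v i)))

/-- `K,ū ⪯ʰᵁ_m K',v̄`: `m`-half-U-bisimulation. -/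
def HalfBisimU (K K' : Struct) (m : ℕ) (u : Fin m → K.World) (v : Fin m → K'.World) : Prop :=
  tupHom K K' u v ∧
  (bisimGame K K' m true).DupWins (.S (fun i => Sum.inl (u i)) (fun i => Sum.inr (v i)))

/-- `K,ū ⇄_m K',v̄`: `m`-bisimulation. -/
def Bisim (K K' : Struct) (m : ℕ) (u : Fin m → K.World) (v : Fin m → K'.World) : Prop :=
  HalfBisim K K' m u v ∧ HalfBisim K' K m v u

/-- `K,ū ⇄ᵁ_m K',v̄`: `m`-U-bisimulation. -/
def BisimU (K K' : Struct) (m : ℕ) (u : Fin m → K.World) (v : Fin m → K'.World) : Prop :=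
  HalfBisimU K K' m u v ∧ HalfBisimU K' K m v u

/-- padding of a single world to an `m`-tuple. -/
def pad1 {W : Type} (m : ℕ) (v : W) : Fin m → W := fun _ => v

/-- padding of a pair of worlds to an `m`-tuple `(u,v,v,…,v)`. -/
def pad2 {W : Type} (m : ℕ) (u v : W) : Fin m → W := fun i => if (i : ℕ) = 0 then u else v

/-- the structure on `W` whose only nonempty relation is the binary relation
named `0`, interpreted as `e`. -/
def Struct.ofEdge (W : Type) (e : W → W → Prop) : Struct where
  World := W
  rel n r t := n = 2 ∧ r = 0 ∧
    ∃ a b, e a b ∧ ∀ i : Fin n, t i = if (i : ℕ) = 0 then a else b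

/-- the structure on `W` whose only nonempty relations are the binary relations
named `0` and `1`, interpreted as `ea` and `eb`. -/
def Struct.ofEdges2 (W : Type) (ea eb : W → W → Prop) : Struct where
  World := W
  rel n r t := n = 2 ∧
    ((r = 0 ∧ ∃ a b, ea a b ∧ ∀ i : Fin n, t i = if (i : ℕ) = 0 then a else b) ∨
     (r = 1 ∧ ∃ a b, eb a b ∧ ∀ i : Fin n, t i = if (i : ℕ) = 0 then a else b))

/-- worlds of the tree `B`: the root `0` (encoded `none`) and the points `(i,j)`
with `1 ≤ j ≤ i`. -/
abbrev BW : Type := Option {p : ℕ × ℕ // 1 ≤ p.2 ∧ p.2 ≤ p.1}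

/-- worlds of the tree `A`: as `B`, but branch indices range over `ℕ ∪ {ω}`,
adding the infinite branch `(ω,1), (ω,2), …`. -/
abbrev AW : Type := Option {p : WithTop ℕ × ℕ // 1 ≤ p.2 ∧ (p.2 : WithTop ℕ) ≤ p.1}

/-- `a`-edges of `B`: from the root to each `(i,1)` and from `(i,j)` to `(i,j+1)`. -/
def Bedge : BW → BW → Prop
  | none, some q => q.1.2 = 1
  | some q, some q' => q'.1.1 = q.1.1 ∧ q'.1.2 = q.1.2 + 1
  | _, _ => False

/-- `a`-edges of `A`. -/
def Aedge : AW → AW → Prop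
  | none, some q => q.1.2 = 1
  | some q, some q' => q'.1.1 = q.1.1 ∧ q'.1.2 = q.1.2 + 1
  | _, _ => False

/-- the tree with one branch of each finite length plus an infinite branch. -/
def StructA : Struct := Struct.ofEdge AW Aedge

/-- the tree with one branch of each finite length. -/
def StructB : Struct := Struct.ofEdge BW Bedge

/-- `h` preserves every relation instance of `K` all of whose entries lie in the list `L`. -/
def HomOn (K K' : Struct) (L : List K.World) (h : K.World → K'.World) : Prop :=
  ∀ (n r : ℕ) (t : Fin n → K.World), (∀ i, t i ∈ L) → K.rel n r t → K'.rel n r fun i => h (t i)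

theorem HomOn.mono {K K' : Struct} {L L' : List K.World} {h : K.World → K'.World}
    (hL : L ⊆ L') (hh : HomOn K K' L' h) : HomOn K K' L h :=
  fun n r t ht => hh n r t fun i => hL (ht i)

theorem HomOn.left {K K' : Struct} {L L' : List K.World} {h : K.World → K'.World}
    (hh : HomOn K K' (L ++ L') h) : HomOn K K' L h :=
  hh.mono (List.subset_append_left _ _)

theorem HomOn.right {K K' : Struct} {L L' : List K.World} {h : K.World → K'.World}
    (hh : HomOn K K' (L ++ L') h) : HomOn K K' L' h :=
  hh.mono (List.subset_append_right _ _)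

theorem HomOn.prog {K K' : Struct} {a : ℕ} {u v : K.World} {h : K.World → K'.World}
    (hh : HomOn K K' [u, v] h) (huv : K.prog a u v) : K'.prog a (h u) (h v) := by
  have := hh 2 a _ (fun i => by split_ifs <;> simp) huv
  simpa only [Struct.prog, apply_ite h] using this

theorem HomOn.ratomSat {K K' : Struct} {f : ℕ → K.World} {r : RAtom} {h : K.World → K'.World}
    (hh : HomOn K K' (r.args.map f) h) (hr : K.ratomSat f r) :
    K'.ratomSat (fun x => h (f x)) r :=
  hh _ _ _ (fun i => List.mem_map_of_mem (List.get_mem _ i)) hr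

section FiniteWitness

variable {K : Struct} (K' : Struct)

mutual

/-- Truth of a positive formula depends on finitely many worlds only: it is preserved by
every map that is a homomorphism on these worlds. -/
theorem Fml.Positive.exists_homOn : ∀ {φ : Fml}, φ.Positive → ∀ {w : K.World}, evalF K φ w →
    ∃ L, ∀ h : K.World → K'.World, HomOn K K' L h → evalF K' φ (h w)
  | .prop p, _, w, hw => by
    simp only [evalF] at hw ⊢
    exact ⟨[w], fun h hh => hh 1 p (fun _ => w) (by simp) hw⟩
  | .neg _, hpos, _, _ => by simp [Fml.Positive] at hpos
  | .and φ ψ, hpos, w, hw => by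
    simp only [Fml.Positive] at hpos
    simp only [evalF] at hw ⊢
    obtain ⟨L₁, h₁⟩ := Fml.Positive.exists_homOn hpos.1 hw.1
    obtain ⟨L₂, h₂⟩ := Fml.Positive.exists_homOn hpos.2 hw.2
    exact ⟨L₁ ++ L₂, fun h hh => ⟨h₁ h hh.left, h₂ h hh.right⟩⟩
  | .diam π, hpos, w, hw => by
    simp only [Fml.Positive] at hpos
    simp only [evalF] at hw ⊢
    obtain ⟨v, hv⟩ := hw
    obtain ⟨L, hL⟩ := Prog.Positive.exists_homOn hpos hv
    exact ⟨L, fun h hh => ⟨h v, hL h hh⟩⟩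
  | .loop π, hpos, w, hw => by
    simp only [Fml.Positive] at hpos
    simp only [evalF] at hw ⊢
    exact Prog.Positive.exists_homOn hpos hw

theorem Prog.Positive.exists_homOn : ∀ {π : Prog}, π.Positive → ∀ {u v : K.World},
    evalP K π u v → ∃ L, ∀ h : K.World → K'.World, HomOn K K' L h → evalP K' π (h u) (h v)
  | .eps, _, u, v, huv => by
    simp only [evalP] at huv ⊢
    exact ⟨[], fun h _ => congrArg h huv⟩
  | .atom a, _, u, v, huv => by
    simp only [evalP] at huv ⊢
    exact ⟨[u, v], fun h hh => hh.prog huv⟩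
  | .conv a, _, u, v, huv => by
    simp only [evalP] at huv ⊢
    exact ⟨[v, u], fun h hh => hh.prog huv⟩
  | .union π₁ π₂, hpos, u, v, huv => by
    simp only [Prog.Positive] at hpos
    simp only [evalP] at huv ⊢
    rcases huv with huv | huv
    · obtain ⟨L, hL⟩ := Prog.Positive.exists_homOn hpos.1 huv
      exact ⟨L, fun h hh => Or.inl (hL h hh)⟩
    · obtain ⟨L, hL⟩ := Prog.Positive.exists_homOn hpos.2 huv
      exact ⟨L, fun h hh => Or.inr (hL h hh)⟩
  | .comp π₁ π₂, hpos, u, v, huv => by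
    simp only [Prog.Positive] at hpos
    simp only [evalP] at huv ⊢
    obtain ⟨w, huw, hwv⟩ := huv
    obtain ⟨L₁, h₁⟩ := Prog.Positive.exists_homOn hpos.1 huw
    obtain ⟨L₂, h₂⟩ := Prog.Positive.exists_homOn hpos.2 hwv
    exact ⟨L₁ ++ L₂, fun h hh => ⟨h w, h₁ h hh.left, h₂ h hh.right⟩⟩
  | .star π, hpos, u, v, huv => by
    simp only [Prog.Positive] at hpos
    simp only [evalP] at huv ⊢
    induction huv with
    | refl => exact ⟨[], fun h _ => .refl⟩
    | tail _ hstep ih =>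
      obtain ⟨L₁, h₁⟩ := ih
      obtain ⟨L₂, h₂⟩ := Prog.Positive.exists_homOn hpos hstep
      exact ⟨L₁ ++ L₂, fun h hh => (h₁ h hh.left).tail (h₂ h hh.right)⟩
  | .test φ, hpos, u, v, huv => by
    simp only [Prog.Positive] at hpos
    simp only [evalP] at huv ⊢
    obtain ⟨L, hL⟩ := Fml.Positive.exists_homOn hpos huv.2
    exact ⟨L, fun h hh => ⟨congrArg h huv.1, hL h hh⟩⟩
  | .inter π₁ π₂, hpos, u, v, huv => by
    simp only [Prog.Positive] at hpos
    simp only [evalP] at huv ⊢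
    obtain ⟨L₁, h₁⟩ := Prog.Positive.exists_homOn hpos.1 huv.1
    obtain ⟨L₂, h₂⟩ := Prog.Positive.exists_homOn hpos.2 huv.2
    exact ⟨L₁ ++ L₂, fun h hh => ⟨h₁ h hh.left, h₂ h hh.right⟩⟩
  | .univ, _, _, _, _ => by
    simp only [evalP]
    exact ⟨[], fun _ _ => trivial⟩
  | .cq ps rs xs xt, hpos, u, v, huv => by
    simp only [Prog.Positive] at hpos
    simp only [evalP] at huv ⊢
    obtain ⟨f, rfl, rfl, hps, hrs⟩ := huv
    obtain ⟨L, hL⟩ := PList.Positive.exists_homOn hpos hps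
    refine ⟨L ++ rs.flatMap fun r => r.args.map f, fun h hh =>
      ⟨fun x => h (f x), rfl, rfl, hL h hh.left, fun r hr => ?_⟩⟩
    exact (hh.right.mono fun x hx => List.mem_flatMap.2 ⟨r, hr, hx⟩).ratomSat (hrs r hr)

theorem PList.Positive.exists_homOn : ∀ {ps : PList}, ps.Positive → ∀ {f : ℕ → K.World},
    evalPL K f ps →
      ∃ L, ∀ h : K.World → K'.World, HomOn K K' L h → evalPL K' (fun x => h (f x)) ps
  | .nil, _, _, _ => by
    simp only [evalPL]
    exact ⟨[], fun _ _ => trivial⟩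
  | .cons π x y ps, hpos, f, hf => by
    simp only [PList.Positive] at hpos
    simp only [evalPL] at hf ⊢
    obtain ⟨L₁, h₁⟩ := Prog.Positive.exists_homOn hpos.1 hf.1
    obtain ⟨L₂, h₂⟩ := PList.Positive.exists_homOn hpos.2 hf.2
    exact ⟨L₁ ++ L₂, fun h hh => ⟨h₁ h hh.left, h₂ h hh.right⟩⟩

end

end FiniteWitness

theorem homOn_ofEdge {W W' : Type} {e : W → W → Prop} {e' : W' → W' → Prop} {L : List W}
    {h : W → W'} (hh : ∀ a ∈ L, ∀ b ∈ L, e a b → e' (h a) (h b)) :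
    HomOn (Struct.ofEdge W e) (Struct.ofEdge W' e') L h := by
  rintro n r t ht ⟨rfl, rfl, a, b, hab, htab⟩
  have ha : t 0 = a := htab 0
  have hb : t 1 = b := htab 1
  exact ⟨rfl, rfl, h a, h b, hh a (ha ▸ ht 0) b (hb ▸ ht 1) hab,
    fun i => (congrArg h (htab i)).trans (apply_ite h _ _ _)⟩

/-- The inclusion of `B` into `A`. -/
def inclBA : BW → AW
  | none => none
  | some q => some ⟨(q.1.1, q.1.2), q.2.1, WithTop.coe_le_coe.2 q.2.2⟩

theorem Aedge_inclBA : ∀ {a b : BW}, Bedge a b → Aedge (inclBA a) (inclBA b)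
  | none, some _, h => h
  | some _, some _, h => ⟨congrArg ((↑) : ℕ → WithTop ℕ) h.1, h.2⟩

/-- The distance of a world of `A` from the root. -/
def depthA : AW → ℕ
  | none => 0
  | some q => q.1.2

/-- The map from `A` to `B` that folds the first `N` worlds of the infinite branch onto the
branch of length `N`, and the remaining worlds of the infinite branch onto the root. -/
def foldAB (N : ℕ) : AW → BW
  | none => none
  | some ⟨(some n, j), hj⟩ => some ⟨(n, j), hj.1, WithTop.coe_le_coe.1 hj.2⟩
  | some ⟨(none, j), hj⟩ => if h : j ≤ N then some ⟨(N, j), hj.1, h⟩ else none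

theorem Bedge_foldAB {N : ℕ} : ∀ {a b : AW}, depthA a ≤ N → depthA b ≤ N → Aedge a b →
    Bedge (foldAB N a) (foldAB N b)
  | none, some ⟨(some n, j), hj⟩, _, _, h => h
  | none, some ⟨(none, j), hj⟩, _, hb, h => by
    have hb : j ≤ N := hb
    simp only [foldAB, hb, dite_true]
    exact h
  | some ⟨(some n, j), hj⟩, some ⟨(some n', j'), hj'⟩, _, _, h =>
    ⟨WithTop.coe_injective h.1, h.2⟩
  | some ⟨(none, j), hj⟩, some ⟨(none, j'), hj'⟩, ha, hb, h => by
    have ha : j ≤ N := ha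
    have hb : j' ≤ N := hb
    simpa [foldAB, ha, hb, Bedge] using h.2
  | some ⟨(some n, j), hj⟩, some ⟨(none, j'), hj'⟩, _, _, h => absurd h.1 (WithTop.top_ne_coe)
  | some ⟨(none, j), hj⟩, some ⟨(some n, j'), hj'⟩, _, _, h => absurd h.1 (WithTop.coe_ne_top)

theorem evalF_structA_iff_structB {φ : Fml} (hφ : φ.Positive) :
    evalF StructA φ (none : AW) ↔ evalF StructB φ (none : BW) := by
  constructor
  · intro h
    obtain ⟨L, hL⟩ := hφ.exists_homOn StructB h
    let L' : List AW := L
    have hN : ∀ a ∈ L', depthA a ≤ (L'.map depthA).sum := fun a ha =>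
      List.single_le_sum (by simp) _ (List.mem_map_of_mem ha)
    exact hL (foldAB (L'.map depthA).sum) (homOn_ofEdge fun a ha b hb =>
      Bedge_foldAB (hN a ha) (hN b hb))
  · intro h
    obtain ⟨L, hL⟩ := hφ.exists_homOn StructA h
    exact hL inclBA (homOn_ofEdge fun _ _ _ _ => Aedge_inclBA)

theorem ofEdge_rel_pair {W : Type} {e : W → W → Prop} {t : Fin 2 → W} :
    (Struct.ofEdge W e).rel 2 0 t ↔ e (t 0) (t 1) := by
  constructor
  · rintro ⟨-, -, a, b, hab, ht⟩
    have ha : t 0 = a := by simpa using ht 0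
    have hb : t 1 = b := by simpa using ht 1
    rwa [ha, hb]
  · refine fun h => ⟨rfl, rfl, _, _, h, fun i => ?_⟩
    fin_cases i <;> rfl

/-- If Spoiler advances pebble `p` along an edge leaving pebble `q`, then Duplicator has to
advance her pebble `p` along an edge as well. -/
theorem exists_edge_of_invariant {W W' : Type} {e : W → W → Prop} {e' : W' → W' → Prop} {m : ℕ}
    {withU : Bool} {X : Set (GPos W W' m)}
    (hX : (simGame (Struct.ofEdge W e) (Struct.ofEdge W' e') m withU).Invariant X)
    {u : Fin m → W} {v : Fin m → W'} (huv : GPos.S u v ∈ X) {p q : Fin m} (hpq : q ≠ p) {w : W}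
    (hw : e (u q) w) :
    ∃ w', e' (v q) w' ∧ GPos.S (Function.update u p w) (Function.update v p w') ∈ X := by
  have hnear : (Struct.ofEdge W e).near (u q) w :=
    Or.inr ⟨2, 0, ![u q, w], ofEdge_rel_pair.2 hw, ⟨0, rfl⟩, ⟨1, rfl⟩⟩
  have hD := (hX _ huv).1 trivial (.D (some p) (Function.update u p w) v)
    ⟨rfl, w, rfl, q, hpq, hnear⟩
  obtain ⟨q', hmove, hq'⟩ := (hX _ hD).2 id
  match q', hmove with
  | .S u' v', hmove =>
    obtain ⟨rfl, ⟨(w' : W'), rfl, -⟩, -, hhom⟩ := hmove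
    refine ⟨w', ?_, hq'⟩
    have hu : e (Function.update u p w q) (Function.update u p w p) := by
      rwa [Function.update_of_ne hpq, Function.update_self]
    have hv : e' (Function.update v p w' q) (Function.update v p w' p) :=
      ofEdge_rel_pair.1 (hhom 2 0 ![q, p] (ofEdge_rel_pair.2 hu))
    rwa [Function.update_of_ne hpq, Function.update_self] at hv

/-- The world at depth `j + 1` on the infinite branch of `A`. -/
def omegaWorld (j : ℕ) : AW := some ⟨(⊤, j + 1), Nat.le_add_left 1 j, le_top⟩

theorem omegaWorld_notMem_of_invariant {withU : Bool} {X : Set (GPos AW BW 2)}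
    (hX : (simGame StructA StructB 2 withU).Invariant X) (k : ℕ) {u : Fin 2 → AW} {v : Fin 2 → BW}
    {p q : Fin 2} (hpq : q ≠ p) {j : ℕ} (hu : u q = omegaWorld j)
    {b : {p : ℕ × ℕ // 1 ≤ p.2 ∧ p.2 ≤ p.1}} (hv : v q = some b) (hk : b.1.1 = b.1.2 + k) :
    GPos.S u v ∉ X := by
  intro huv
  induction k generalizing u v p q j b with
  | zero =>
    obtain ⟨w', hw', -⟩ := exists_edge_of_invariant hX huv hpq (w := omegaWorld (j + 1))
      (by rw [hu]; exact ⟨rfl, rfl⟩)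
    rw [hv] at hw'
    match w', hw' with
    | some c, hw' =>
      have h₁ := hw'.1
      have h₂ := hw'.2
      have h₃ := c.2.2
      omega
  | succ k ih =>
    obtain ⟨w', hw', hmem⟩ := exists_edge_of_invariant hX huv hpq (w := omegaWorld (j + 1))
      (by rw [hu]; exact ⟨rfl, rfl⟩)
    rw [hv] at hw'
    match w', hw' with
    | some c, hw' =>
      refine ih hpq.symm (Function.update_self ..) (Function.update_self ..) ?_ hmem
      have h₁ := hw'.1
      have h₂ := hw'.2
      omega

theorem not_dupWins_structA_structB (withU : Bool) :
    ¬ (simGame StructA StructB 2 withU).DupWins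
      (.S (pad1 2 (none : AW)) (pad1 2 (none : BW))) := by
  rintro ⟨X, hX, hmem⟩
  obtain ⟨w', hw', hmem'⟩ := exists_edge_of_invariant hX hmem (p := 0) (q := 1) (by decide)
    (w := omegaWorld 0) rfl
  match w', hw' with
  | some c, _ =>
    obtain ⟨k, hk⟩ := Nat.exists_eq_add_of_le c.2.2
    exact omegaWorld_notMem_of_invariant hX k (p := 1) (q := 0) (by decide)
      (Function.update_self ..) (Function.update_self ..) hk hmem'

/-- The finite-degree hypothesis in the simulation
characterization theorem is necessary: `A,0` and `B,0` satisfy exactly the same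
positive UCPDL⁺ formulas, yet `A,0 ⋠₂ B,0`, hence also `A,0 ⋠ᵁ₂ B,0`. -/
theorem statement_7 :
    (∀ φ : Fml, Fml.In Frag.ucpdlPlus φ → Fml.Positive φ →
      (evalF StructA φ (none : AW) ↔ evalF StructB φ (none : BW))) ∧
    ¬ PebbleSim StructA StructB 2 (pad1 2 (none : AW)) (pad1 2 (none : BW)) ∧
    ¬ PebbleSimU StructA StructB 2 (pad1 2 (none : AW)) (pad1 2 (none : BW)) := by
  exact ⟨fun φ _ hφ => evalF_structA_iff_structB hφ,
    fun h => not_dupWins_structA_structB false (h fun _ _ => .refl).2,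
    fun h => not_dupWins_structA_structB true h.2⟩

end PaperCPDL
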